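/- Let n ≥ 1 and let p_1, …, p_{n+2} ∈ K^n be points such that every subset of n + 1 of them is affinely independent. Then for all integers d ≥ 0 and m_1, …, m_{n+2} ≥ 0, the space L_{n,d}(m_1, …, m_{n+2}) contains a nonzero polynomial if and only if m_i ≤ d for every i and Σ_{i∈I} m_i ≤ n·d for every subset I ⊆ {1,…,n+2} with |I| = n + 1 or |I| = n + 2. (Characterization of effective divisors dH − Σ m_i E_i on the blow-up of ℙ^n at n + 2 points in general position.) -/

import Mathlib

/-- Iterated partial derivative `∂^α` as a linear endomorphism of the polynomial ring. -/
noncomputable def pd {K : Type*} [CommSemiring K] {n : ℕ} (α : Fin n → ℕ) :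
    MvPolynomial (Fin n) K →ₗ[K] MvPolynomial (Fin n) K :=
  (List.finRange n).foldl
    (fun L i => ((MvPolynomial.pderiv i).toLinearMap ^ α i) ∘ₗ L) LinearMap.id

/-- `F` has multiplicity at least `m` at `p`: all partial derivatives of order `≤ m - 1`
vanish at `p`. -/
def hasMultAtLeast {K : Type*} [CommSemiring K] {n : ℕ} (m : ℕ) (p : Fin n → K)
    (F : MvPolynomial (Fin n) K) : Prop :=
  ∀ α : Fin n → ℕ, (∑ j, α j) < m → MvPolynomial.eval p (pd α F) = 0


open MvPolynomial in
/-- Translation of the origin to `p`. -/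
noncomputable def shiftP {K : Type*} [CommRing K] {n : ℕ} (p : Fin n → K) :
    MvPolynomial (Fin n) K →ₐ[K] MvPolynomial (Fin n) K :=
  aeval (fun i => X i + C (p i))

section aux
open MvPolynomial

variable {K : Type*} [Field K] {n : ℕ}

lemma pderiv_shiftP (p : Fin n → K) (i : Fin n) (F : MvPolynomial (Fin n) K) :
    pderiv i (shiftP p F) = shiftP p (pderiv i F) := by
  classical
  induction F using MvPolynomial.induction_on with
  | C a => simp [shiftP]
  | add f g hf hg => simp [hf, hg]
  | mul_X f j hf =>
    rw [map_mul, Derivation.leibniz, Derivation.leibniz, hf]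
    simp only [smul_eq_mul, map_add, map_mul]
    have : pderiv i (shiftP p (X j)) = shiftP p (pderiv i (X j : MvPolynomial (Fin n) K)) := by
      by_cases h : j = i
      · subst h; simp [shiftP]
      · simp [shiftP, pderiv_X_of_ne h]
    rw [this]

lemma pow_pderiv_shiftP (p : Fin n → K) (i : Fin n) (k : ℕ) (F : MvPolynomial (Fin n) K) :
    ((pderiv i).toLinearMap ^ k) (shiftP p F)
      = shiftP p (((pderiv i : Derivation K _ _).toLinearMap ^ k) F) := by
  induction k generalizing F with
  | zero => simp
  | succ k ih =>
    rw [pow_succ, Module.End.mul_apply, Module.End.mul_apply, ← ih]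
    congr 1
    exact pderiv_shiftP p i F

lemma pd_shiftP (p : Fin n → K) (α : Fin n → ℕ) (F : MvPolynomial (Fin n) K) :
    pd α (shiftP p F) = shiftP p (pd α F) := by
  unfold pd
  suffices h : ∀ (l : List (Fin n)) (L : MvPolynomial (Fin n) K →ₗ[K] MvPolynomial (Fin n) K),
      L (shiftP p F) = shiftP p (L F) →
      (l.foldl (fun L i => ((pderiv i).toLinearMap ^ α i) ∘ₗ L) L) (shiftP p F)
      = shiftP p ((l.foldl (fun L i => ((pderiv i).toLinearMap ^ α i) ∘ₗ L) L) F) from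
    h _ _ rfl
  intro l
  induction l with
  | nil => intro L h; simpa using h
  | cons a l ih =>
    intro L h
    rw [List.foldl_cons]
    apply ih
    rw [LinearMap.comp_apply, LinearMap.comp_apply, h, pow_pderiv_shiftP]

lemma coeff_pderiv_ex (i : Fin n) (γ : Fin n →₀ ℕ) (G : MvPolynomial (Fin n) K) :
    coeff γ (pderiv i G) = ((γ i + 1 : ℕ) : K) * coeff (γ + Finsupp.single i 1) G := by
  classical
  induction G using MvPolynomial.induction_on' with
  | add p q hp hq => simp [hp, hq, mul_add]
  | monomial u a =>
    rw [pderiv_monomial, coeff_monomial, coeff_monomial]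
    by_cases h : u = γ + Finsupp.single i 1
    · subst h; simp [mul_comm]
    · rw [if_neg h, mul_zero]
      split_ifs with h2
      · by_cases hu : u i = 0
        · simp [hu]
        · exfalso
          apply h
          rw [← h2, tsub_add_cancel_of_le]
          simp
          omega
      · rfl

lemma coeff_pow_pderiv_ex [CharZero K] (i : Fin n) (k : ℕ) (γ : Fin n →₀ ℕ) : ∃ c : K, c ≠ 0 ∧
    ∀ G : MvPolynomial (Fin n) K, coeff γ (((pderiv i).toLinearMap ^ k) G)
      = c * coeff (γ + Finsupp.single i k) G := by
  induction k with
  | zero => exact ⟨1, one_ne_zero, by simp⟩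
  | succ k ih =>
    obtain ⟨c, hc, h⟩ := ih
    refine ⟨c * (((γ + Finsupp.single i k) i + 1 : ℕ) : K),
      mul_ne_zero hc (Nat.cast_ne_zero.2 (by omega)), fun G => ?_⟩
    rw [pow_succ, Module.End.mul_apply, h]
    change c * coeff _ (pderiv i G) = _
    rw [coeff_pderiv_ex, add_assoc γ, ← Finsupp.single_add, mul_assoc]

lemma coeff_pd_ex [CharZero K] (α : Fin n → ℕ) : ∃ c : K, c ≠ 0 ∧
    ∀ G : MvPolynomial (Fin n) K, coeff 0 (pd α G)
      = c * coeff (Finsupp.equivFunOnFinite.symm α) G := by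
  have h : ∀ (l : List (Fin n)) (γ : Fin n →₀ ℕ), ∃ c : K, c ≠ 0 ∧
      ∀ (L : MvPolynomial (Fin n) K →ₗ[K] MvPolynomial (Fin n) K) (G : MvPolynomial (Fin n) K),
      coeff γ ((l.foldl (fun L i => ((pderiv i).toLinearMap ^ α i) ∘ₗ L) L) G)
        = c * coeff (γ + (l.map (fun i => Finsupp.single i (α i))).sum) (L G) := by
    intro l
    induction l with
    | nil => intro γ; exact ⟨1, one_ne_zero, by simp⟩
    | cons a l ih =>
      intro γ
      obtain ⟨c, hc, h⟩ := ih γ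
      obtain ⟨c', hc', h'⟩ := coeff_pow_pderiv_ex (K := K) a (α a)
        (γ + (l.map (fun i => Finsupp.single i (α i))).sum)
      refine ⟨c * c', mul_ne_zero hc hc', fun L G => ?_⟩
      rw [List.foldl_cons, h, LinearMap.comp_apply, h', mul_assoc, List.map_cons, List.sum_cons,
        add_assoc, add_comm (List.sum _)]
  obtain ⟨c, hc, h⟩ := h (List.finRange n) 0
  refine ⟨c, hc, fun G => ?_⟩
  unfold pd
  rw [h]
  congr 2
  rw [zero_add, ← List.ofFn_eq_map, List.sum_ofFn]
  ext i
  simp [Finsupp.finsetSum_apply, Finsupp.single_apply]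

lemma eval_eq_coeff_shiftP (p : Fin n → K) (F : MvPolynomial (Fin n) K) :
    eval p F = coeff 0 (shiftP p F) := by
  rw [← constantCoeff_eq]
  have : (eval p : MvPolynomial (Fin n) K →+* K) = constantCoeff.comp (shiftP p).toRingHom := by
    ext i <;> simp [shiftP]
  rw [this]; rfl

lemma hasMult_iff [CharZero K] (m : ℕ) (p : Fin n → K) (F : MvPolynomial (Fin n) K) :
    hasMultAtLeast m p F ↔ ∀ α : Fin n →₀ ℕ, α.degree < m → coeff α (shiftP p F) = 0 := by
  unfold hasMultAtLeast
  have key : ∀ α : Fin n → ℕ, eval p (pd α F) = 0 ↔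
      coeff (Finsupp.equivFunOnFinite.symm α) (shiftP p F) = 0 := by
    intro α
    obtain ⟨c, hc, h⟩ := coeff_pd_ex (K := K) α
    rw [eval_eq_coeff_shiftP, ← pd_shiftP, h]
    simp [hc]
  constructor
  · intro h α hα
    have := (key α).1 (h α (by rwa [Finsupp.degree_eq_sum] at hα))
    simpa using this
  · intro h α hα
    exact (key α).2 (h _ (by rw [Finsupp.degree_eq_sum]; simpa using hα))

lemma hasMult_mul [CharZero K] {a b : ℕ} {p : Fin n → K} {F G : MvPolynomial (Fin n) K}
    (hF : hasMultAtLeast a p F) (hG : hasMultAtLeast b p G) :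
    hasMultAtLeast (a + b) p (F * G) := by
  classical
  rw [hasMult_iff] at *
  intro α hα
  rw [map_mul, coeff_mul]
  apply Finset.sum_eq_zero
  intro x hx
  rw [Finset.HasAntidiagonal.mem_antidiagonal] at hx
  have : x.1.degree + x.2.degree = α.degree := by rw [← hx, map_add]
  by_cases h : x.1.degree < a
  · rw [hF _ h, zero_mul]
  · rw [hG _ (by omega), mul_zero]

lemma hasMult_zero (p : Fin n → K) (F : MvPolynomial (Fin n) K) : hasMultAtLeast 0 p F := by
  intro α h; omega

lemma hasMult_one [CharZero K] {p : Fin n → K} {F : MvPolynomial (Fin n) K} (h : eval p F = 0) :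
    hasMultAtLeast 1 p F := by
  rw [hasMult_iff]
  intro α hα
  have : α = 0 := by
    rw [← Finsupp.degree_eq_zero_iff]; omega
  rw [this, ← eval_eq_coeff_shiftP, h]

lemma exists_linear (S : Finset (Fin (n+2))) (hS : S.card ≤ n) (p : Fin (n + 2) → Fin n → K) :
    ∃ l : MvPolynomial (Fin n) K, l ≠ 0 ∧ l.totalDegree ≤ 1 ∧ ∀ i ∈ S, eval (p i) l = 0 := by
  let T : (K × (Fin n → K)) →ₗ[K] ({x // x ∈ S} → K) :=
    { toFun := fun v i => v.1 + ∑ j, v.2 j * p i.1 j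
      map_add' := by
        intro v w; ext i; simp [add_mul, Finset.sum_add_distrib]; ring
      map_smul' := by
        intro c v; ext i; simp [mul_add, Finset.mul_sum, mul_assoc] }
  have hlt : Module.finrank K ({x // x ∈ S} → K) < Module.finrank K (K × (Fin n → K)) := by
    simp; omega
  have := LinearMap.ker_ne_bot_of_finrank_lt (f := T) hlt
  obtain ⟨v, hv, hv0⟩ := (Submodule.ne_bot_iff _).1 this
  refine ⟨C v.1 + ∑ j, C (v.2 j) * X j, ?_, ?_, ?_⟩
  · intro h0
    apply hv0
    have h1 : v.1 = 0 := by
      have := congrArg (eval 0) h0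
      simpa using this
    ext j
    · exact h1
    · have := congrArg (eval (Pi.single j 1)) h0
      simpa [h1, Pi.single_apply] using this
  · refine (totalDegree_add _ _).trans (max_le (by simp) ?_)
    refine totalDegree_finsetSum_le ?_
    intro i _
    refine (totalDegree_mul _ _).trans ?_
    simp
  · intro i hi
    have := congrFun (LinearMap.mem_ker.1 hv) ⟨i, hi⟩
    simpa [T] using this

lemma suff [CharZero K] (p : Fin (n + 2) → Fin n → K) (d : ℕ) : ∀ (m : Fin (n + 2) → ℕ),
    (∀ i, m i ≤ d) → ∑ i, m i ≤ n * d →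
    ∃ F : MvPolynomial (Fin n) K, F ≠ 0 ∧ F.totalDegree ≤ d ∧
          ∀ i, hasMultAtLeast (m i) (p i) F := by
  induction d with
  | zero =>
    intro m hm _
    refine ⟨1, one_ne_zero, by simp, fun i => ?_⟩
    rw [Nat.le_zero.1 (hm i)]
    exact hasMult_zero _ _
  | succ d ih =>
    intro m hm hs
    obtain ⟨S, hSn, hAS, hsum⟩ : ∃ S : Finset (Fin (n+2)), S.card ≤ n ∧ (∀ i, m i = d + 1 → i ∈ S) ∧
        ∑ i, (m i - if i ∈ S then 1 else 0) ≤ n * d := by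
      set A := Finset.univ.filter (fun i => m i = d + 1) with hA
      set B := Finset.univ.filter (fun i => 0 < m i) with hB
      have hAB : A ⊆ B := by intro i; simp [hA, hB]; omega
      have hAn : A.card ≤ n := by
        have h1 : ∑ i ∈ A, m i ≤ ∑ i, m i := Finset.sum_le_sum_of_subset (Finset.subset_univ _)
        have h2 : ∑ i ∈ A, m i = A.card * (d + 1) := by
          rw [Finset.sum_congr rfl (g := fun _ => d + 1)]
          · simp
          · intro i hi; simpa [hA] using hi
        exact Nat.le_of_mul_le_mul_right (by omega : A.card * (d+1) ≤ n * (d+1)) (by omega)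
      by_cases hBn : B.card ≤ n
      · refine ⟨B, hBn, fun i hi => hAB (by simp [hA, hi]), ?_⟩
        calc ∑ i, (m i - if i ∈ B then 1 else 0) ≤ ∑ i, (if i ∈ B then d else 0) := by
              apply Finset.sum_le_sum
              intro i _
              have := hm i
              split_ifs with h
              · omega
              · simp [hB] at h; omega
          _ = B.card * d := by simp [Finset.sum_ite_mem]
          _ ≤ n * d := Nat.mul_le_mul_right _ hBn
      · obtain ⟨S, h1, h2, h3⟩ := Finset.exists_subsuperset_card_eq hAB hAn (by omega)
        refine ⟨S, h3.le, fun i hi => h1 (by simp [hA, hi]), ?_⟩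
        have : ∑ i, (m i - if i ∈ S then 1 else 0) + ∑ i, (if i ∈ S then 1 else 0) = ∑ i, m i := by
          rw [← Finset.sum_add_distrib]
          apply Finset.sum_congr rfl
          intro i _
          split_ifs with h
          · have := h2 h
            simp [hB] at this; omega
          · simp
        have h4 : ∑ i, (if i ∈ S then 1 else 0) = n := by simp [h3]
        rw [mul_add] at hs
        omega
    obtain ⟨F, hF0, hFd, hF⟩ := ih (fun i => m i - if i ∈ S then 1 else 0) (by
      intro i
      have := hm i
      by_cases h : m i = d + 1
      · simp [hAS i h, h]
      · exact (Nat.sub_le _ _).trans (by omega)) hsum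
    obtain ⟨l, hl0, hl1, hl⟩ := exists_linear S hSn p
    refine ⟨F * l, mul_ne_zero hF0 hl0, (totalDegree_mul _ _).trans (by omega), fun i => ?_⟩
    have h1 := hF i
    by_cases h : i ∈ S
    · have h2 := hasMult_mul h1 (hasMult_one (hl i h))
      intro α hα
      exact h2 α (by simp [h]; omega)
    · have h2 := hasMult_mul h1 (hasMult_zero (p i) l)
      intro α hα
      exact h2 α (by simpa [h] using hα)

end aux

section aux2
open MvPolynomial

variable {K : Type*} [Field K] {n : ℕ}

/-- Value at `(w, z)` of the degree-`d` homogenization of `F`. -/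
noncomputable def homEval {R : Type*} [CommRing R] [Algebra K R] (d : ℕ)
    (F : MvPolynomial (Fin n) K) (w : R) (z : Fin n → R) : R :=
  ∑ α ∈ F.support, algebraMap K R (coeff α F) * w ^ (d - α.degree) * ∏ i, z i ^ α i

lemma degree_le_of_mem {d : ℕ} {F : MvPolynomial (Fin n) K} (hF : F.totalDegree ≤ d)
    {α : Fin n →₀ ℕ} (h : α ∈ F.support) : α.degree ≤ d := by
  refine le_trans ?_ hF
  exact le_totalDegree h

lemma homEval_field {L : Type*} [Field L] [Algebra K L] {d : ℕ} {F : MvPolynomial (Fin n) K}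
    (hF : F.totalDegree ≤ d) {w : L} (hw : w ≠ 0) (z : Fin n → L) :
    homEval d F w z = w ^ d * aeval (fun i => z i / w) F := by
  unfold homEval
  rw [aeval_def, eval₂_eq', Finset.mul_sum]
  apply Finset.sum_congr rfl
  intro α hα
  have h := degree_le_of_mem hF hα
  simp only [div_pow]
  rw [Finset.prod_div_distrib, Finset.prod_pow_eq_pow_sum, ← Finsupp.degree_eq_sum]
  have : w ^ d = w ^ (d - α.degree) * w ^ α.degree := by
    rw [← pow_add]; congr 1; omega
  rw [this]
  field_simp

lemma map_homEval {R S : Type*} [CommRing R] [Algebra K R] [CommRing S] [Algebra K S]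
    (f : R →ₐ[K] S) (d : ℕ) (F : MvPolynomial (Fin n) K) (w : R) (z : Fin n → R) :
    f (homEval d F w z) = homEval d F (f w) (fun i => f (z i)) := by
  simp [homEval, map_sum, map_mul, map_pow, map_prod]

lemma totalDegree_shiftP (p : Fin n → K) (F : MvPolynomial (Fin n) K) :
    (shiftP p F).totalDegree ≤ F.totalDegree := by
  unfold shiftP
  rw [aeval_def, eval₂_eq']
  apply totalDegree_finsetSum_le
  intro α hα
  refine (totalDegree_mul _ _).trans ?_
  rw [algebraMap_eq, totalDegree_C, zero_add]
  refine (totalDegree_finsetProd _ _).trans ?_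
  refine le_trans (Finset.sum_le_sum (g := fun i => α i) ?_) ?_
  · intro i _
    refine (totalDegree_pow _ _).trans ?_
    have : (X i + C (p i) : MvPolynomial (Fin n) K).totalDegree ≤ 1 :=
      (totalDegree_add _ _).trans (by simp)
    nlinarith
  · rw [← Finsupp.degree_eq_sum]
    exact degree_le_of_mem le_rfl hα

lemma homEval_shiftP {R : Type*} [CommRing R] [IsDomain R] [Algebra K R] {d : ℕ}
    {F : MvPolynomial (Fin n) K} (hF : F.totalDegree ≤ d) {w : R} (hw : w ≠ 0) (y : Fin n → R)
    (p : Fin n → K) :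
    homEval d F w y = homEval d (shiftP p F) w (fun i => y i - algebraMap K R (p i) * w) := by
  let f : R →ₐ[K] FractionRing R := IsScalarTower.toAlgHom K R (FractionRing R)
  have hf : Function.Injective f := IsFractionRing.injective R (FractionRing R)
  apply hf
  have hw' : f w ≠ 0 := by
    rw [← map_zero f]; exact fun h => hw (hf h)
  rw [map_homEval, map_homEval, homEval_field hF hw',
    homEval_field ((totalDegree_shiftP p F).trans hF) hw']
  congr 1
  unfold shiftP
  rw [← AlgHom.comp_apply]
  congr 1
  ext i
  simp only [aeval_X, AlgHom.comp_apply, map_add, map_sub, map_mul, AlgHom.commutes]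
  rw [← algebraMap_eq, AlgHom.commutes]
  field_simp
  ring

lemma homEval_dvd [CharZero K] {R : Type*} [CommRing R] [IsDomain R] [Algebra K R] {d m : ℕ}
    {F : MvPolynomial (Fin n) K} (hF : F.totalDegree ≤ d) {w : R} (hw : w ≠ 0) (y : Fin n → R)
    (p : Fin n → K) (hm : hasMultAtLeast m p F) (u : R)
    (hu : ∀ i, u ∣ y i - algebraMap K R (p i) * w) :
    u ^ m ∣ homEval d F w y := by
  rw [homEval_shiftP hF hw y p]
  rw [hasMult_iff] at hm
  apply Finset.dvd_sum
  intro α hα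
  apply Dvd.dvd.mul_left
  have h1 : m ≤ α.degree := by
    by_contra h
    exact (mem_support_iff.1 hα) (hm α (by omega))
  refine (pow_dvd_pow u h1).trans ?_
  rw [Finsupp.degree_eq_sum, ← Finset.prod_pow_eq_pow_sum]
  exact Finset.prod_dvd_prod_of_dvd _ _ fun i _ => pow_dvd_pow_of_dvd (hu i) _

lemma homEval_natDegree {d N : ℕ} {F : MvPolynomial (Fin n) K} (hF : F.totalDegree ≤ d)
    {w : Polynomial K} {y : Fin n → Polynomial K} (hw : w.natDegree ≤ N)
    (hy : ∀ i, (y i).natDegree ≤ N) : (homEval d F w y).natDegree ≤ N * d := by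
  apply Polynomial.natDegree_sum_le_of_forall_le
  intro α hα
  have h := degree_le_of_mem hF hα
  rw [mul_assoc]
  refine (Polynomial.natDegree_C_mul_le _ _).trans ?_
  refine Polynomial.natDegree_mul_le.trans ?_
  have h1 : (w ^ (d - α.degree)).natDegree ≤ (d - α.degree) * N :=
    Polynomial.natDegree_pow_le_of_le _ hw
  have h2 : (∏ i, y i ^ α i).natDegree ≤ α.degree * N := by
    refine (Polynomial.natDegree_prod_le _ _).trans ?_
    rw [Finsupp.degree_eq_sum, Finset.sum_mul]
    exact Finset.sum_le_sum fun i _ => Polynomial.natDegree_pow_le_of_le _ (hy i)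
  calc _ ≤ (d - α.degree) * N + α.degree * N := add_le_add h1 h2
    _ = N * d := by rw [← add_mul, Nat.sub_add_cancel h, mul_comm]

lemma homEval_one {d : ℕ} {F : MvPolynomial (Fin n) K} (hF : F.totalDegree ≤ d) (q : Fin n → K) :
    homEval d F (1 : K) q = eval q F := by
  rw [homEval_field hF one_ne_zero]
  simp [MvPolynomial.coe_aeval_eq_eval]

lemma exists_eval_ne [CharZero K] {F : MvPolynomial (Fin n) K} (hF : F ≠ 0) :
    ∃ q, eval q F ≠ 0 := by
  by_contra! h
  exact hF (MvPolynomial.funext (fun q => by simpa using h q))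

lemma mult_le [CharZero K] {d m : ℕ} {F : MvPolynomial (Fin n) K} (hF0 : F ≠ 0)
    (hF : F.totalDegree ≤ d) {p : Fin n → K} (hm : hasMultAtLeast m p F) : m ≤ d := by
  obtain ⟨q, hq⟩ := exists_eval_ne hF0
  set y : Fin n → Polynomial K := fun i => Polynomial.C (p i) + Polynomial.X * Polynomial.C (q i - p i)
  have h1 : (Polynomial.X : Polynomial K) ^ m ∣ homEval d F 1 y := by
    apply homEval_dvd hF one_ne_zero y p hm
    intro i
    simp [y, ← Polynomial.C_eq_algebraMap]
  have h2 : homEval d F 1 y ≠ 0 := by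
    intro h
    apply hq
    have := congrArg (Polynomial.aeval (1 : K)) h
    rw [map_homEval] at this
    simpa [y, homEval_one hF] using this
  have h3 : (homEval d F 1 y).natDegree ≤ 1 * d := by
    apply homEval_natDegree hF (by simp)
    intro i
    simp only [y]
    compute_degree
  have := Polynomial.natDegree_le_of_dvd h1 h2
  rw [Polynomial.natDegree_X_pow] at this
  omega

lemma geom (p : Fin (n + 2) → Fin n → K)
    (hgen : ∀ I : Finset (Fin (n + 2)), I.card = n + 1 →
      AffineIndependent K (fun i : {x // x ∈ I} => p i.1)) :
    ∃ lam : Fin (n + 2) → K, ∑ j, lam j = 0 ∧ (∀ i, ∑ j, lam j * p j i = 0) ∧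
      ∀ q : Fin n → K, ∃ u : Fin (n + 2) → K, ∑ j, lam j * u j = 1 ∧
        ∀ i, ∑ j, lam j * u j * p j i = q i := by
  let T : (Fin (n + 2) → K) →ₗ[K] (K × (Fin n → K)) :=
    ∑ j, (LinearMap.proj j).smulRight ((1 : K), p j)
  have hT : ∀ v, T v = (∑ j, v j, fun i => ∑ j, v j * p j i) := by
    intro v
    ext i
    · simp [T, Prod.fst_sum]
    · simp [T, Prod.snd_sum]
  have hind : ∀ j0 v, T v = 0 → v j0 = 0 → v = 0 := by
    intro j0 v hv h0
    have hc : (Finset.univ.erase j0).card = n + 1 := by simp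
    have h := (affineIndependent_iff (k := K)).1 (hgen _ hc) Finset.univ (fun i => v i.1)
    rw [hT, Prod.mk_eq_zero] at hv
    have key : ∀ (g : Fin (n+2) → K), ∑ i : {x // x ∈ Finset.univ.erase j0}, v i.1 * g i.1
        = ∑ i, v i * g i := by
      intro g
      rw [Finset.sum_coe_sort (Finset.univ.erase j0) (fun i => v i * g i)]
      apply Finset.sum_erase
      simp [h0]
    have h := h (by simpa [hv.1] using key 1) (by
      ext i
      have := key (fun j => p j i)
      rw [congrFun hv.2 i] at this
      simpa using this)
    ext j
    by_cases hj : j = j0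
    · rw [hj, h0]; rfl
    · exact h ⟨j, by simp [hj]⟩ (Finset.mem_univ _)
  have hlt : Module.finrank K (K × (Fin n → K)) < Module.finrank K (Fin (n+2) → K) := by
    simp; omega
  obtain ⟨lam, hl, hl0⟩ := (Submodule.ne_bot_iff _).1 (LinearMap.ker_ne_bot_of_finrank_lt hlt : LinearMap.ker T ≠ ⊥)
  rw [LinearMap.mem_ker] at hl
  have hne : ∀ j, lam j ≠ 0 := fun j hj => hl0 (hind j lam hl hj)
  let E : (Fin (n + 1) → K) →ₗ[K] (Fin (n + 2) → K) :=
    LinearMap.pi (fun j => Fin.cases 0 (fun k => LinearMap.proj k) j)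
  have hE0 : ∀ v, E v 0 = 0 := fun v => rfl
  have hEs : ∀ v k, E v (Fin.succ k) = v k := fun v k => rfl
  have hinj : Function.Injective (T ∘ₗ E) := by
    rw [← LinearMap.ker_eq_bot, LinearMap.ker_eq_bot']
    intro v hv
    have := hind 0 (E v) hv (hE0 v)
    ext k
    rw [← hEs v k, this]; rfl
  have hsurj := (LinearMap.injective_iff_surjective_of_finrank_eq_finrank (f := T ∘ₗ E)
    (by simp; omega)).1 hinj
  have hl' := hl
  rw [hT, Prod.mk_eq_zero] at hl'
  refine ⟨lam, hl'.1, fun i => congrFun hl'.2 i, fun q => ?_⟩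
  obtain ⟨v, hv⟩ := hsurj (1, q)
  rw [LinearMap.comp_apply, hT, Prod.mk.injEq] at hv
  refine ⟨fun j => E v j / lam j, ?_, fun i => ?_⟩
  · simp_rw [mul_div_cancel₀ _ (hne _)]; exact hv.1
  · simp_rw [mul_div_cancel₀ _ (hne _)]; exact congrFun hv.2 i

/-- Coordinates of the rational normal curve. -/
noncomputable def crv (lam s a : Fin (n + 2) → K) : Polynomial K :=
  ∑ j, Polynomial.C (lam j * s j * a j) *
    ∏ k ∈ Finset.univ.erase j, (Polynomial.C (s k) * Polynomial.X + Polynomial.C 1)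

lemma crv_eval (lam s a : Fin (n + 2) → K) : (crv lam s a).eval 0 = ∑ j, lam j * s j * a j := by
  simp [crv, Polynomial.eval_finsetSum, Polynomial.eval_prod]

lemma crv_natDegree (lam s a : Fin (n + 2) → K) (h : ∑ j, lam j * a j = 0) :
    (crv lam s a).natDegree ≤ n := by
  have hlin : ∀ k, (Polynomial.C (s k) * Polynomial.X + Polynomial.C 1).natDegree ≤ 1 :=
    fun k => Polynomial.natDegree_linear_le
  rw [Polynomial.natDegree_le_iff_coeff_eq_zero]
  intro N hN
  rcases Nat.lt_or_ge (n + 1) N with h1 | h1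
  · apply Polynomial.coeff_eq_zero_of_natDegree_lt
    refine lt_of_le_of_lt ?_ h1
    apply Polynomial.natDegree_sum_le_of_forall_le
    intro j _
    refine (Polynomial.natDegree_C_mul_le _ _).trans ((Polynomial.natDegree_prod_le _ _).trans ?_)
    refine (Finset.sum_le_card_nsmul _ _ 1 (fun k _ => hlin k)).trans ?_
    simp
  · have hNe : N = n + 1 := by omega
    subst hNe
    have hc : ∀ j, (∏ k ∈ Finset.univ.erase j,
        (Polynomial.C (s k) * Polynomial.X + Polynomial.C 1)).coeff (n + 1)
        = ∏ k ∈ Finset.univ.erase j, s k := by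
      intro j
      have := Polynomial.coeff_prod_of_natDegree_le (s := Finset.univ.erase j)
        (fun k => (Polynomial.C (s k) * Polynomial.X + Polynomial.C 1)) 1 (fun k _ => hlin k)
      simpa [Polynomial.coeff_one] using this
    unfold crv
    rw [Polynomial.finsetSum_coeff]
    simp_rw [Polynomial.coeff_C_mul, hc]
    have : ∀ j, lam j * s j * a j * ∏ k ∈ Finset.univ.erase j, s k
        = (lam j * a j) * ∏ k, s k := by
      intro j
      rw [← Finset.mul_prod_erase Finset.univ s (Finset.mem_univ j)]
      ring
    simp_rw [this]
    rw [← Finset.sum_mul, h, zero_mul]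

lemma crv_dvd (lam s a : Fin (n + 2) → K) (i : Fin (n + 2)) :
    (Polynomial.C (s i) * Polynomial.X + Polynomial.C 1) ∣
      crv lam s a - Polynomial.C (a i) * crv lam s 1 := by
  unfold crv
  rw [Finset.mul_sum, ← Finset.sum_sub_distrib]
  apply Finset.dvd_sum
  intro j _
  by_cases hj : j = i
  · subst hj
    have : ∀ Q : Polynomial K, Polynomial.C (lam j * s j * a j) * Q
      - Polynomial.C (a j) * (Polynomial.C (lam j * s j * (1 : Fin (n+2) → K) j) * Q) = 0 := by
      intro Q; simp; ring
    rw [this]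
    exact dvd_zero _
  · have : (Polynomial.C (s i) * Polynomial.X + Polynomial.C 1) ∣ ∏ k ∈ Finset.univ.erase j,
        (Polynomial.C (s k) * Polynomial.X + Polynomial.C 1) :=
      Finset.dvd_prod_of_mem _ (by simp [Ne.symm hj])
    exact dvd_sub (this.mul_left _) ((this.mul_left _).mul_left _)

lemma exists_params [CharZero K] {d : ℕ} {F : MvPolynomial (Fin n) K} (hF0 : F ≠ 0)
    (hF : F.totalDegree ≤ d) (p : Fin (n + 2) → Fin n → K) (lam : Fin (n + 2) → K)
    (hq : ∀ q : Fin n → K, ∃ u : Fin (n + 2) → K, ∑ j, lam j * u j = 1 ∧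
        ∀ i, ∑ j, lam j * u j * p j i = q i) :
    ∃ s : Fin (n + 2) → K, (∀ j, s j ≠ 0) ∧ (∀ j k, j ≠ k → s j ≠ s k) ∧
      ∑ j, lam j * s j ≠ 0 ∧
      homEval d F (∑ j, lam j * s j) (fun i => ∑ j, lam j * s j * p j i) ≠ 0 := by
  obtain ⟨q, hqF⟩ := exists_eval_ne hF0
  obtain ⟨u, hu1, hu⟩ := hq q
  let S : Fin (n + 2) → Polynomial K := fun j =>
    Polynomial.C ((j : ℕ) + 1 : K) * Polynomial.X + Polynomial.C (u j)
  let W : Polynomial K := ∑ j, Polynomial.C (lam j) * S j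
  let Y : Fin n → Polynomial K := fun i => ∑ j, Polynomial.C (lam j) * S j * Polynomial.C (p j i)
  have hS1 : ∀ j, S j ≠ 0 := by
    intro j h
    have := congrArg (fun P => Polynomial.coeff P 1) h
    simp [S] at this
    exact Nat.cast_add_one_ne_zero _ this
  have hS2 : ∀ j k, j ≠ k → S j - S k ≠ 0 := by
    intro j k hjk h
    have := congrArg (fun P => Polynomial.coeff P 1) h
    simp [S, sub_eq_zero] at this
    exact hjk (Fin.ext this)
  have hW : W ≠ 0 := by
    intro h
    have := congrArg (Polynomial.eval 0) h
    simp [W, S, Polynomial.eval_finsetSum, hu1] at this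
  have hH : homEval d F W Y ≠ 0 := by
    intro h
    have := congrArg (Polynomial.aeval (0 : K)) h
    rw [map_homEval] at this
    simp [W, Y, S, hu1, hu, homEval_one hF] at this
    exact hqF this
  have hP : homEval d F W Y * W * (∏ j, S j) *
      (∏ x ∈ (Finset.univ : Finset (Fin (n+2))).offDiag, (S x.1 - S x.2)) ≠ 0 := by
    refine mul_ne_zero (mul_ne_zero (mul_ne_zero hH hW) ?_) ?_
    · exact Finset.prod_ne_zero_iff.2 fun j _ => hS1 j
    · exact Finset.prod_ne_zero_iff.2 fun x hx => hS2 _ _ (by simpa using hx)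
  obtain ⟨e, he⟩ : ∃ e : K, Polynomial.eval e (homEval d F W Y * W * (∏ j, S j) *
      (∏ x ∈ (Finset.univ : Finset (Fin (n+2))).offDiag, (S x.1 - S x.2))) ≠ 0 := by
    by_contra! h
    exact hP (Polynomial.funext (fun r => by simpa using h r))
  rw [Polynomial.eval_mul, Polynomial.eval_mul, Polynomial.eval_mul, Polynomial.eval_prod,
    Polynomial.eval_prod, mul_ne_zero_iff, mul_ne_zero_iff, mul_ne_zero_iff,
    Finset.prod_ne_zero_iff, Finset.prod_ne_zero_iff] at he
  obtain ⟨⟨⟨h1, h2⟩, h3⟩, h4⟩ := he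
  have hWe : Polynomial.eval e W = ∑ j, lam j * (S j).eval e := by
    simp [W, Polynomial.eval_finsetSum]
  refine ⟨fun j => (S j).eval e, fun j => h3 j (Finset.mem_univ _), fun j k hjk => ?_, ?_, ?_⟩
  · have := h4 (j, k) (by simp [hjk])
    rw [Polynomial.eval_sub] at this
    exact sub_ne_zero.1 this
  · rwa [hWe] at h2
  · have h5 := map_homEval (Polynomial.aeval e) d F W Y
    rw [Polynomial.coe_aeval_eq_eval] at h5
    rw [h5, hWe] at h1
    convert h1 using 2
    ext i
    simp [Y, Polynomial.eval_finsetSum]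

lemma nec [CharZero K] (p : Fin (n + 2) → Fin n → K)
    (hgen : ∀ I : Finset (Fin (n + 2)), I.card = n + 1 →
      AffineIndependent K (fun i : {x // x ∈ I} => p i.1)) {d : ℕ} {m : Fin (n + 2) → ℕ}
    {F : MvPolynomial (Fin n) K} (hF0 : F ≠ 0) (hF : F.totalDegree ≤ d)
    (hm : ∀ i, hasMultAtLeast (m i) (p i) F) : ∑ i, m i ≤ n * d := by
  obtain ⟨lam, hl0, hlp, hq⟩ := geom p hgen
  obtain ⟨s, hs0, hsd, hw, hH⟩ := exists_params hF0 hF p lam hq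
  set w := crv lam s 1 with hwdef
  set y : Fin n → Polynomial K := fun i => crv lam s (fun j => p j i) with hy
  have hw0 : w.eval 0 = ∑ j, lam j * s j := by rw [hwdef, crv_eval]; simp
  have hwne : w ≠ 0 := by
    intro h
    rw [h] at hw0
    exact hw (by simpa using hw0.symm)
  have hne : homEval d F w y ≠ 0 := by
    intro h
    apply hH
    have h5 := map_homEval (Polynomial.aeval (0 : K)) d F w y
    rw [h, map_zero, Polynomial.coe_aeval_eq_eval, hw0] at h5
    simp only [hy, crv_eval] at h5
    exact h5.symm
  have hdeg : (homEval d F w y).natDegree ≤ n * d := by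
    apply homEval_natDegree hF
    · exact crv_natDegree _ _ _ (by simpa using hl0)
    · intro i; exact crv_natDegree _ _ _ (hlp i)
  have hdvd : ∏ i, (Polynomial.C (s i) * Polynomial.X + Polynomial.C 1) ^ m i ∣ homEval d F w y := by
    apply Finset.prod_dvd_of_coprime
    · intro j _ k _ hjk
      apply IsCoprime.pow
      have hne := sub_ne_zero.2 (hsd j k hjk)
      refine ⟨Polynomial.C (-(s k) / (s j - s k)), Polynomial.C (s j / (s j - s k)), ?_⟩
      have h1 : -(s k) / (s j - s k) * s j + s j / (s j - s k) * s k = 0 := by field_simp; ring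
      have h2 : -(s k) / (s j - s k) + s j / (s j - s k) = 1 := by field_simp; ring
      calc _ = Polynomial.C (-(s k) / (s j - s k) * s j + s j / (s j - s k) * s k) * Polynomial.X
            + Polynomial.C (-(s k) / (s j - s k) + s j / (s j - s k)) := by
              simp only [Polynomial.C_add, Polynomial.C_mul, Polynomial.C_1]; ring
        _ = 1 := by rw [h1, h2]; simp
    · intro i _
      exact homEval_dvd hF hwne y (p i) (hm i) _ (fun k => crv_dvd lam s (fun j => p j k) i)
  have := Polynomial.natDegree_le_of_dvd hdvd hne
  rw [Polynomial.natDegree_prod _ _ (fun i _ => pow_ne_zero _ (fun h => by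
    have := congrArg (fun P => Polynomial.coeff P 0) h
    simp at this))] at this
  simp only [Polynomial.natDegree_pow, Polynomial.natDegree_linear (hs0 _), mul_one] at this
  omega

end aux2

/-- Characterization of effective divisors `dH - Σ mᵢEᵢ` on the blow-up of `ℙⁿ` at
`n + 2` points in linearly general position: the linear system `L_{n,d}(m₁,…,m_{n+2})`
is nonzero iff `mᵢ ≤ d` for all `i` and `Σ_{i∈I} mᵢ ≤ n·d` for all `I` with
`|I| = n+1, n+2`. -/
theorem stmt_15 {K : Type*} [Field K] [IsAlgClosed K] [CharZero K]
    (n : ℕ) (hn : 1 ≤ n) (p : Fin (n + 2) → Fin n → K)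
    (hgen : ∀ I : Finset (Fin (n + 2)), I.card = n + 1 →
      AffineIndependent K (fun i : {x // x ∈ I} => p i.1)) :
    ∀ (d : ℕ) (m : Fin (n + 2) → ℕ),
      ((∃ F : MvPolynomial (Fin n) K, F ≠ 0 ∧ F.totalDegree ≤ d ∧
          ∀ i, hasMultAtLeast (m i) (p i) F) ↔
        ((∀ i, m i ≤ d) ∧
          ∀ I : Finset (Fin (n + 2)), (I.card = n + 1 ∨ I.card = n + 2) →
            (∑ i ∈ I, m i) ≤ n * d)) := by
  intro d m
  constructor
  · rintro ⟨F, hF0, hF, hm⟩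
    refine ⟨fun i => mult_le hF0 hF (hm i), fun I _ => ?_⟩
    exact (Finset.sum_le_sum_of_subset (Finset.subset_univ I)).trans (nec p hgen hF0 hF hm)
  · rintro ⟨h1, h2⟩
    exact suff p d m h1 (h2 Finset.univ (Or.inr (by simp)))
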